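/- Let C be a connected component of the upper level set [f]_λ and let v ∈ C with f(v) > alt_f(C). Then the connected component of [f]_{f(v)} containing v is a node of CC(f) strictly contained in C; in particular v is not a proper pixel of C. -/

import Mathlib

/-- The upper level set of an image `f` at level `lam`. -/
def upper {V : Type*} (f : V → ℝ) (lam : ℝ) : Set V := {v | lam ≤ f v}

/-- `C` is a connected component of the subset `X` of the vertices of `G`:
it is the set of vertices of `X` reachable from some `v ∈ X` within the
subgraph of `G` induced on `X`. -/
def IsCompOf {V : Type*} (G : SimpleGraph V) (X : Set V) (C : Set V) : Prop :=
  ∃ v, ∃ hv : v ∈ X, C = {u | ∃ hu : u ∈ X, (G.induce X).Reachable ⟨u, hu⟩ ⟨v, hv⟩}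

/-- The set of connected components of all upper level sets of `f` (the nodes of the max-tree). -/
def CC {V : Type*} (G : SimpleGraph V) (f : V → ℝ) : Set (Set V) :=
  {C | ∃ lam : ℝ, IsCompOf G (upper f lam) C}

/-- The set of levels `lam` such that `C` is a connected component of the upper
level set of `f` at level `lam`. The altitude of `C` is the greatest element of this set. -/
def altSet {V : Type*} (G : SimpleGraph V) (f : V → ℝ) (C : Set V) : Set ℝ :=
  {lam | IsCompOf G (upper f lam) C}

/-- `v` is a proper pixel of the node `C`: it belongs to `C` and to no strictly smaller node. -/
def ProperPixel {V : Type*} (G : SimpleGraph V) (f : V → ℝ) (C : Set V) (v : V) : Prop :=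
  v ∈ C ∧ ∀ D ∈ CC G f, D ⊂ C → v ∉ D

theorem IsCompOf.subset_of_subset {V : Type*} {G : SimpleGraph V} {X Y D C : Set V} (hXY : X ⊆ Y)
    (hD : IsCompOf G X D) (hC : IsCompOf G Y C) {v : V} (hvD : v ∈ D) (hvC : v ∈ C) : D ⊆ C := by
  obtain ⟨d, hd, rfl⟩ := hD
  obtain ⟨c, hc, rfl⟩ := hC
  obtain ⟨hvX, hvd⟩ := hvD
  obtain ⟨hvY, hvc⟩ := hvC
  rintro u ⟨hu, hud⟩
  exact ⟨hXY hu, ((hud.trans hvd.symm).map (G.induceHomOfLE hXY).toHom).trans hvc⟩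

theorem exists_isCompOf_mem {V : Type*} (G : SimpleGraph V) {X : Set V} {v : V} (hv : v ∈ X) :
    ∃ D : Set V, IsCompOf G X D ∧ v ∈ D :=
  ⟨_, ⟨v, hv, rfl⟩, hv, .refl _⟩

/-- let `C` be a connected component of the upper level set `[f]_lam` and
`v ∈ C` with `f v` strictly above the altitude of `C`. Then the connected component of
`[f]_{f v}` containing `v` exists, is a node of `CC f` strictly contained in `C`; in
particular `v` is not a proper pixel of `C`. -/
theorem strict_subnode_of_value_gt_altitude
    {V : Type*} [Fintype V] [Nonempty V] (G : SimpleGraph V) (f : V → ℝ)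
    (lam : ℝ) (C : Set V) (hC : IsCompOf G (upper f lam) C)
    (a : ℝ) (ha : IsGreatest (altSet G f C) a)
    (v : V) (hv : v ∈ C) (hfv : f v > a) :
    (∃ D : Set V, IsCompOf G (upper f (f v)) D ∧ v ∈ D) ∧
    (∀ D : Set V, IsCompOf G (upper f (f v)) D → v ∈ D → D ∈ CC G f ∧ D ⊂ C) ∧
    ¬ ProperPixel G f C v := by
  have hfv_mem : v ∈ upper f (f v) := le_refl (f v)
  have hsub : ∀ D : Set V, IsCompOf G (upper f (f v)) D → v ∈ D → D ∈ CC G f ∧ D ⊂ C := by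
    intro D hD hvD
    refine ⟨⟨f v, hD⟩, LE.le.ssubset_of_ne ?_ ?_⟩
    · exact hD.subset_of_subset (fun u (hu : f v ≤ f u) => hfv.le.trans hu) ha.1 hvD hv
    · rintro rfl
      exact (ha.2 hD).not_gt hfv
  obtain ⟨D, hD, hvD⟩ := exists_isCompOf_mem G hfv_mem
  have hnode := hsub D hD hvD
  exact ⟨⟨D, hD, hvD⟩, hsub, fun hproper => hproper.2 D hnode.1 hnode.2 hvD⟩
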